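/- arXiv:math/0611827 — 5 statements merged into one kernel-verified Lean document; each statement's English description precedes it below -/
import Mathlib

section
/- Let A ∈ SL(2, ℝ) and Λ_A = A·ℤ². Then sys(g_t·Λ_A) → 0 as t → +∞ (i.e. the torus ℝ²/Λ_A goes to infinity under the Teichmüller geodesic flow) if and only if Λ_A contains a nonzero vector whose first coordinate is 0. -/
open MeasureTheory Filter Topology

/-- The Euclidean norm of a vector in `ℝ²`. -/
noncomputable def vnorm (w : Fin 2 → ℝ) : ℝ := Real.sqrt (w 0 ^ 2 + w 1 ^ 2)

/-- The Teichmüller geodesic flow matrix `g_t = diag(e^t, e^{-t})`. -/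
noncomputable def gmat (t : ℝ) : Matrix (Fin 2) (Fin 2) ℝ :=
  !![Real.exp t, 0; 0, Real.exp (-t)]

/-- The lattice `A·ℤ² ⊆ ℝ²`, image of `ℤ²` under `A`. -/
def latticeSet (A : Matrix (Fin 2) (Fin 2) ℝ) : Set (Fin 2 → ℝ) :=
  {w | ∃ q : Fin 2 → ℤ, w = A.mulVec fun i => (q i : ℝ)}

/-- The systole of a lattice `Λ ⊆ ℝ²`: the infimum of the Euclidean norms of its
nonzero vectors. -/
noncomputable def sys (Λ : Set (Fin 2 → ℝ)) : ℝ :=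
  sInf {r | ∃ w ∈ Λ, w ≠ 0 ∧ r = vnorm w}

theorem vnorm_nonneg (w : Fin 2 → ℝ) : 0 ≤ vnorm w := Real.sqrt_nonneg _

theorem vnorm_sq (w : Fin 2 → ℝ) : vnorm w ^ 2 = w 0 ^ 2 + w 1 ^ 2 :=
  Real.sq_sqrt (by positivity)

theorem abs_apply_zero_le_vnorm (w : Fin 2 → ℝ) : |w 0| ≤ vnorm w :=
  Real.abs_le_sqrt (by nlinarith [sq_nonneg (w 1)])

theorem abs_cross_le_vnorm_mul_vnorm (v w : Fin 2 → ℝ) :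
    |v 0 * w 1 - v 1 * w 0| ≤ vnorm v * vnorm w := by
  apply abs_le_of_sq_le_sq _ (mul_nonneg (vnorm_nonneg v) (vnorm_nonneg w))
  rw [mul_pow, vnorm_sq, vnorm_sq]
  nlinarith [sq_nonneg (v 0 * w 0 + v 1 * w 1)]

theorem det_gmat_mul (t : ℝ) (A : Matrix (Fin 2) (Fin 2) ℝ) : (gmat t * A).det = A.det := by
  rw [Matrix.det_mul]
  simp [gmat, Matrix.det_fin_two, ← Real.exp_add]

theorem gmat_mul_mulVec_zero (t : ℝ) (A : Matrix (Fin 2) (Fin 2) ℝ) (q : Fin 2 → ℝ) :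
    (gmat t * A).mulVec q 0 = Real.exp t * A.mulVec q 0 := by
  rw [← Matrix.mulVec_mulVec]
  simp [gmat, Matrix.mulVec, dotProduct]

theorem gmat_mul_mulVec_one (t : ℝ) (A : Matrix (Fin 2) (Fin 2) ℝ) (q : Fin 2 → ℝ) :
    (gmat t * A).mulVec q 1 = Real.exp (-t) * A.mulVec q 1 := by
  rw [← Matrix.mulVec_mulVec]
  simp [gmat, Matrix.mulVec, dotProduct]

theorem mulVec_intCast_ne_zero {B : Matrix (Fin 2) (Fin 2) ℝ} (hB : B.det = 1)
    {q : Fin 2 → ℤ} (hq : q ≠ 0) : (B.mulVec fun i => (q i : ℝ)) ≠ 0 := by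
  intro h
  have h0 := Matrix.eq_zero_of_mulVec_eq_zero (by rw [hB]; exact one_ne_zero) h
  exact hq (funext fun i => by simpa using congrFun h0 i)

theorem sys_nonneg (Λ : Set (Fin 2 → ℝ)) : 0 ≤ sys Λ := by
  apply Real.sInf_nonneg
  rintro _ ⟨w, -, -, rfl⟩
  exact vnorm_nonneg w

theorem sys_le_vnorm {Λ : Set (Fin 2 → ℝ)} {w : Fin 2 → ℝ} (hw : w ∈ Λ) (h0 : w ≠ 0) :
    sys Λ ≤ vnorm w := by
  refine csInf_le ⟨0, ?_⟩ ⟨w, hw, h0, rfl⟩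
  rintro _ ⟨u, -, -, rfl⟩
  exact vnorm_nonneg u

theorem exists_vnorm_lt_of_sys_lt {B : Matrix (Fin 2) (Fin 2) ℝ} (hB : B.det = 1) {ε : ℝ}
    (h : sys (latticeSet B) < ε) :
    ∃ q : Fin 2 → ℤ, q ≠ 0 ∧ vnorm (B.mulVec fun i => (q i : ℝ)) < ε := by
  have hne : {r | ∃ w ∈ latticeSet B, w ≠ 0 ∧ r = vnorm w}.Nonempty :=
    ⟨_, _, ⟨1, rfl⟩, mulVec_intCast_ne_zero hB one_ne_zero, rfl⟩
  obtain ⟨_, ⟨_, ⟨q, rfl⟩, h0, rfl⟩, hlt⟩ := exists_lt_of_csInf_lt hne h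
  refine ⟨q, ?_, hlt⟩
  rintro rfl
  exact h0 (by ext; simp [Matrix.mulVec, dotProduct])

/-- Two integer vectors whose images under a unimodular matrix span a parallelogram of area
less than one are parallel. -/
theorem cross_eq_zero_of_vnorm_mul_lt_one {B : Matrix (Fin 2) (Fin 2) ℝ} (hB : B.det = 1)
    {p q : Fin 2 → ℤ}
    (h : vnorm (B.mulVec fun i => (p i : ℝ)) * vnorm (B.mulVec fun i => (q i : ℝ)) < 1) :
    p 0 * q 1 = p 1 * q 0 := by
  have hlt := (abs_cross_le_vnorm_mul_vnorm _ _).trans_lt h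
  have hcross : (B.mulVec fun i => (p i : ℝ)) 0 * (B.mulVec fun i => (q i : ℝ)) 1 -
      (B.mulVec fun i => (p i : ℝ)) 1 * (B.mulVec fun i => (q i : ℝ)) 0 =
      ((p 0 * q 1 - p 1 * q 0 : ℤ) : ℝ) := by
    rw [Matrix.det_fin_two] at hB
    simp only [Matrix.mulVec, dotProduct, Fin.sum_univ_two]
    push_cast
    linear_combination ((p 0 : ℝ) * q 1 - p 1 * q 0) * hB
  rw [hcross] at hlt
  have : |p 0 * q 1 - p 1 * q 0| < 1 := by exact_mod_cast hlt
  exact sub_eq_zero.mp (Int.abs_lt_one_iff.mp this)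

theorem cross_eq_zero_trans {p q r : Fin 2 → ℤ} (hq : q ≠ 0) (hpq : p 0 * q 1 = p 1 * q 0)
    (hqr : q 0 * r 1 = q 1 * r 0) : p 0 * r 1 = p 1 * r 0 := by
  by_cases h0 : q 0 = 0
  · have h1 : q 1 ≠ 0 := fun h1 => hq (by ext i; fin_cases i <;> simp [h0, h1])
    apply mul_left_cancel₀ h1
    linear_combination r 1 * hpq + p 1 * hqr
  · apply mul_left_cancel₀ h0
    linear_combination r 0 * hpq + p 0 * hqr

/-- The first coordinates of the images of nonzero integer vectors parallel to `p` are bounded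
away from zero as soon as that of `p` does not vanish. -/
theorem abs_mulVec_zero_le_of_cross_eq_zero (A : Matrix (Fin 2) (Fin 2) ℝ) {p q : Fin 2 → ℤ}
    (hq : q ≠ 0) (hpq : p 0 * q 1 = p 1 * q 0) :
    |(A.mulVec fun i => (p i : ℝ)) 0| ≤
      (|(p 0 : ℝ)| + |(p 1 : ℝ)|) * |(A.mulVec fun i => (q i : ℝ)) 0| := by
  have hpqR : (p 0 : ℝ) * q 1 = p 1 * q 0 := by exact_mod_cast hpq
  obtain ⟨i, hi⟩ := Function.ne_iff.mp hq
  have hi1 : (1 : ℝ) ≤ |(q i : ℝ)| := by exact_mod_cast Int.one_le_abs hi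
  have key : (q i : ℝ) * (A.mulVec fun i => (p i : ℝ)) 0 =
      p i * (A.mulVec fun i => (q i : ℝ)) 0 := by
    simp only [Matrix.mulVec, dotProduct, Fin.sum_univ_two]
    fin_cases i
    · simp only [Fin.zero_eta]
      linear_combination -A 0 1 * hpqR
    · simp only [Fin.mk_one]
      linear_combination A 0 0 * hpqR
  have hp : |(p i : ℝ)| ≤ |(p 0 : ℝ)| + |(p 1 : ℝ)| := by
    fin_cases i <;> simp
  calc |(A.mulVec fun i => (p i : ℝ)) 0|
      ≤ |(q i : ℝ)| * |(A.mulVec fun i => (p i : ℝ)) 0| :=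
        le_mul_of_one_le_left (abs_nonneg _) hi1
    _ = |(p i : ℝ)| * |(A.mulVec fun i => (q i : ℝ)) 0| := by rw [← abs_mul, key, abs_mul]
    _ ≤ _ := mul_le_mul_of_nonneg_right hp (abs_nonneg _)

theorem vnorm_gmat_add_one_le (t : ℝ) (A : Matrix (Fin 2) (Fin 2) ℝ) (q : Fin 2 → ℝ) :
    vnorm ((gmat (t + 1) * A).mulVec q) ≤ Real.exp 1 * vnorm ((gmat t * A).mulVec q) := by
  refine (pow_le_pow_iff_left₀ (vnorm_nonneg _)
    (mul_nonneg (Real.exp_pos 1).le (vnorm_nonneg _)) two_ne_zero).mp ?_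
  rw [mul_pow, vnorm_sq, vnorm_sq, mul_add]
  simp only [gmat_mul_mulVec_zero, gmat_mul_mulVec_one, ← mul_pow, ← mul_assoc, ← Real.exp_add]
  rw [add_comm 1 t]
  gcongr ?_ + ?_
  · exact le_rfl
  · rw [mul_pow, mul_pow]
    gcongr
    linarith

/-- For `A ∈ SL(2, ℝ)`, the systole of `g_t·Λ_A` tends to `0` as `t → +∞` (the torus
`ℝ²/Λ_A` goes to infinity under the Teichmüller geodesic flow) if and only if the
lattice `Λ_A = A·ℤ²` contains a nonzero vector with vanishing first coordinate. -/
theorem sys_tendsto_zero_iff_vertical_vector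
    (A : Matrix (Fin 2) (Fin 2) ℝ) (hA : A.det = 1) :
    Tendsto (fun t : ℝ => sys (latticeSet (gmat t * A))) atTop (𝓝 0) ↔
      ∃ w ∈ latticeSet A, w ≠ 0 ∧ w 0 = 0 := by
  constructor
  · intro h
    by_contra! hvert
    have hdet (t : ℝ) : (gmat t * A).det = 1 := (det_gmat_mul t A).trans hA
    obtain ⟨T, hT⟩ := eventually_atTop.mp (h.eventually (gt_mem_nhds (one_half_pos (α := ℝ))))
    have hshort (n : ℕ) := exists_vnorm_lt_of_sys_lt (hdet (T + n)) (hT (T + n) (by simp))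
    choose q hq0 hq using hshort
    have hpar (n : ℕ) : q 0 0 * q n 1 = q 0 1 * q n 0 := by
      induction n with
      | zero => ring
      | succ n ih =>
        refine cross_eq_zero_trans (hq0 n) ih
          (cross_eq_zero_of_vnorm_mul_lt_one (hdet (T + (n + 1 : ℕ))) ?_)
        have hstep := vnorm_gmat_add_one_le (T + n) A fun i => (q n i : ℝ)
        rw [add_assoc, ← Nat.cast_add_one] at hstep
        have hlt := hq n
        have hlt' := hq (n + 1)
        have he := Real.exp_one_lt_three
        have hexp : Real.exp 1 * vnorm ((gmat (T + n) * A).mulVec fun i => (q n i : ℝ)) ≤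
            3 * (1 / 2) :=
          mul_le_mul he.le hlt.le (vnorm_nonneg _) (by norm_num)
        nlinarith [mul_le_mul (hstep.trans hexp) hlt'.le (vnorm_nonneg _) (by norm_num)]
    have hx : 0 < |(A.mulVec fun i => (q 0 i : ℝ)) 0| :=
      abs_pos.mpr (hvert _ ⟨q 0, rfl⟩ (mulVec_intCast_ne_zero hA (hq0 0)))
    have hbound (n : ℕ) : Real.exp (T + n) * |(A.mulVec fun i => (q 0 i : ℝ)) 0| ≤
        (|(q 0 0 : ℝ)| + |(q 0 1 : ℝ)|) * (1 / 2) := by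
      have h1 := abs_mulVec_zero_le_of_cross_eq_zero A (hq0 n) (hpar n)
      have h2 := (abs_apply_zero_le_vnorm _).trans (hq n).le
      rw [gmat_mul_mulVec_zero, abs_mul, Real.abs_exp] at h2
      calc _ ≤ Real.exp (T + n) * ((|(q 0 0 : ℝ)| + |(q 0 1 : ℝ)|) *
              |(A.mulVec fun i => (q n i : ℝ)) 0|) := by gcongr
        _ = (|(q 0 0 : ℝ)| + |(q 0 1 : ℝ)|) * (Real.exp (T + n) *
              |(A.mulVec fun i => (q n i : ℝ)) 0|) := by ring
        _ ≤ _ := by gcongr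
    have hlim : Tendsto (fun n : ℕ => Real.exp (T + n) * |(A.mulVec fun i => (q 0 i : ℝ)) 0|)
        atTop atTop :=
      (Real.tendsto_exp_atTop.comp
        (tendsto_atTop_add_const_left _ T tendsto_natCast_atTop_atTop)).atTop_mul_const hx
    obtain ⟨n, hn⟩ := (hlim.eventually_gt_atTop _).exists
    exact (hbound n).not_gt hn
  · rintro ⟨_, ⟨q, rfl⟩, h0, hx⟩
    have hq : q ≠ 0 := by
      rintro rfl
      exact h0 (by ext; simp [Matrix.mulVec, dotProduct])
    have hlim : Tendsto (fun t : ℝ => Real.exp (-t) * |(A.mulVec fun i => (q i : ℝ)) 1|)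
        atTop (𝓝 0) := by
      simpa using (Real.tendsto_exp_neg_atTop_nhds_zero).mul_const _
    refine squeeze_zero (fun t => sys_nonneg _) (fun t => ?_) hlim
    refine (sys_le_vnorm (Λ := latticeSet (gmat t * A)) ⟨q, rfl⟩
      (mulVec_intCast_ne_zero ((det_gmat_mul t A).trans hA) hq)).trans_eq ?_
    rw [vnorm, gmat_mul_mulVec_zero, gmat_mul_mulVec_one, hx]
    simp [Real.sqrt_sq_eq_abs, abs_mul]
end

section
/- (Masur's criterion in genus 1) Let A ∈ SL(2, ℝ) and Λ_A = A·ℤ². If sys(g_t·Λ_A) does not tend to 0 as t → +∞, then the vertical flow ψ_t(x) = x + t·(0,1) mod Λ_A on the compact quotient group ℝ²/Λ_A is uniquely ergodic: the Haar probability measure on ℝ²/Λ_A is the unique Borel probability measure invariant under ψ_t for every t ∈ ℝ. -/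
open MeasureTheory Filter Topology

/-- The group homomorphism `ℤ² →+ ℝ²`, `q ↦ A·q`. -/
def latticeHom (A : Matrix (Fin 2) (Fin 2) ℝ) : (Fin 2 → ℤ) →+ (Fin 2 → ℝ) :=
  A.mulVecLin.toAddMonoidHom.comp ((Int.castAddHom ℝ).compLeft (Fin 2))

/-- The lattice `Λ_A = A·ℤ²` as an additive subgroup of `ℝ²`. -/
def latticeSub (A : Matrix (Fin 2) (Fin 2) ℝ) : AddSubgroup (Fin 2 → ℝ) :=
  (latticeHom A).range

/-- The flat torus `ℝ²/Λ_A`. -/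
abbrev TorusMod (A : Matrix (Fin 2) (Fin 2) ℝ) : Type := (Fin 2 → ℝ) ⧸ latticeSub A

/-- The lattice `A·ℤ²` with `det A = 1` is closed in `ℝ²`. -/
theorem isClosed_latticeSub (A : Matrix (Fin 2) (Fin 2) ℝ) (hA : A.det = 1) :
    IsClosed (latticeSub A : Set (Fin 2 → ℝ)) := by
  have hu : IsUnit A.det := by rw [hA]; exact isUnit_one
  have heq : (latticeSub A : Set (Fin 2 → ℝ)) =
      (fun w : Fin 2 → ℝ => A⁻¹.mulVec w) ⁻¹'
        Set.univ.pi fun _ => Set.range ((↑) : ℤ → ℝ) := by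
    ext w
    simp only [Set.mem_preimage, Set.mem_univ_pi, Set.mem_range]
    constructor
    · rintro ⟨q, rfl⟩ i
      refine ⟨q i, ?_⟩
      change _ = (A⁻¹.mulVec (A.mulVec fun j => (q j : ℝ))) i
      rw [Matrix.mulVec_mulVec, Matrix.nonsing_inv_mul A hu, Matrix.one_mulVec]
    · intro hw
      choose q hq using hw
      refine ⟨q, ?_⟩
      change A.mulVec (fun j => (q j : ℝ)) = w
      rw [funext hq, Matrix.mulVec_mulVec, Matrix.mul_nonsing_inv A hu, Matrix.one_mulVec]
  rw [heq]
  refine IsClosed.preimage (by fun_prop) (isClosed_set_pi fun _ _ => ?_)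
  exact Int.isClosedEmbedding_coe_real.isClosed_range

/-- A lattice with a nonzero vertical vector is contracted by the geodesic flow. -/
theorem tendsto_sys_of_vertical (A : Matrix (Fin 2) (Fin 2) ℝ) (hA : A.det = 1)
    (q : Fin 2 → ℤ) (hq : q ≠ 0) (hv : A 0 0 * q 0 + A 0 1 * q 1 = 0) :
    Tendsto (fun t : ℝ => sys (latticeSet (gmat t * A))) atTop (𝓝 0) := by
  set b : ℝ := A 1 0 * q 0 + A 1 1 * q 1 with hb
  rw [Matrix.det_fin_two] at hA
  have hb0 : b ≠ 0 := by
    intro h0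
    apply hq
    have e0 : (q 0 : ℝ) = 0 := by
      linear_combination (-(q 0 : ℝ)) * hA + A 1 1 * hv - A 0 1 * (hb.symm.trans h0)
    have e1 : (q 1 : ℝ) = 0 := by
      linear_combination (-(q 1 : ℝ)) * hA - A 1 0 * hv + A 0 0 * (hb.symm.trans h0)
    ext i
    fin_cases i
    · exact_mod_cast e0
    · exact_mod_cast e1
  have hvec : ∀ t : ℝ, ((gmat t * A).mulVec fun i => (q i : ℝ)) = ![0, Real.exp (-t) * b] := by
    intro t
    rw [← Matrix.mulVec_mulVec]
    ext i
    fin_cases i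
    · simp [gmat, Matrix.mulVec, dotProduct, Fin.sum_univ_two, hv]
    · simp [gmat, Matrix.mulVec, dotProduct, Fin.sum_univ_two, hb]
  have hlim : Tendsto (fun t : ℝ => Real.exp (-t) * |b|) atTop (𝓝 0) := by
    simpa using Real.tendsto_exp_neg_atTop_nhds_zero.mul_const |b|
  have hnonneg : ∀ t : ℝ, ∀ r ∈ {r | ∃ w ∈ latticeSet (gmat t * A), w ≠ 0 ∧ r = vnorm w},
      0 ≤ r := by
    rintro t r ⟨w, -, -, rfl⟩
    exact Real.sqrt_nonneg _
  refine squeeze_zero (fun t => Real.sInf_nonneg (hnonneg t)) (fun t => ?_) hlim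
  refine csInf_le ⟨0, hnonneg t⟩ ⟨![0, Real.exp (-t) * b], ⟨q, (hvec t).symm⟩, ?_, ?_⟩
  · intro h0
    have h1 := congrFun h0 1
    simp [hb0] at h1
  · simp [vnorm, Real.sqrt_sq_eq_abs, abs_mul]

/-- Without nonzero vertical lattice vectors, the vertical line through `0` is dense in the
torus. -/
theorem dense_range_vertical (A : Matrix (Fin 2) (Fin 2) ℝ)
    (hv : ∀ q : Fin 2 → ℤ, A 0 0 * q 0 + A 0 1 * q 1 = 0 → q = 0) :
    DenseRange fun t : ℝ => (QuotientAddGroup.mk (![0, t] : Fin 2 → ℝ) : TorusMod A) := by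
  let φ : (Fin 2 → ℝ) →+ ℝ := Pi.evalAddMonoidHom (fun _ => ℝ) 0
  let S : AddSubgroup ℝ := (latticeSub A).map φ
  have hmem : ∀ x : ℝ, x ∈ S ↔ ∃ q : Fin 2 → ℤ, A 0 0 * q 0 + A 0 1 * q 1 = x := by
    intro x
    have key : ∀ q : Fin 2 → ℤ, φ (latticeHom A q) = A 0 0 * q 0 + A 0 1 * q 1 := by
      intro q
      simp [φ, latticeHom]
    constructor
    · rintro ⟨_, ⟨q, rfl⟩, rfl⟩
      exact ⟨q, (key q).symm⟩
    · rintro ⟨q, rfl⟩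
      exact ⟨_, ⟨q, rfl⟩, key q⟩
  have hS : Dense (S : Set ℝ) := by
    rcases AddSubgroup.dense_or_cyclic S with hd | ⟨c, hc⟩
    · exact hd
    · exfalso
      have h0 : A 0 0 ∈ S := (hmem _).2 ⟨![1, 0], by simp⟩
      have h1 : A 0 1 ∈ S := (hmem _).2 ⟨![0, 1], by simp⟩
      rw [hc, AddSubgroup.mem_closure_singleton] at h0 h1
      obtain ⟨k, hk⟩ := h0
      obtain ⟨l, hl⟩ := h1
      simp only [zsmul_eq_mul] at hk hl
      have hkl := hv ![l, -k] (by simp [← hk, ← hl]; ring)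
      have hl0 : l = 0 := by simpa using congrFun hkl 0
      have h00 : A 0 1 = 0 := by rw [← hl, hl0]; simp
      have := congrFun (hv ![0, 1] (by simp [h00])) 1
      simp at this
  have hproj : ∀ x ∈ S, ∀ y : ℝ, (QuotientAddGroup.mk (![x, y] : Fin 2 → ℝ) : TorusMod A) ∈
      Set.range fun t : ℝ => (QuotientAddGroup.mk (![0, t] : Fin 2 → ℝ) : TorusMod A) := by
    rintro x ⟨w, hw, rfl⟩ y
    refine ⟨y - w 1, QuotientAddGroup.eq.2 ?_⟩
    have hw' : -![0, y - w 1] + ![φ w, y] = w := by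
      ext i
      fin_cases i <;> simp [φ]
    rw [hw']
    exact hw
  intro z
  obtain ⟨v, rfl⟩ := QuotientAddGroup.mk_surjective z
  have hcont : Continuous fun x : ℝ =>
      (QuotientAddGroup.mk (![x, v 1] : Fin 2 → ℝ) : TorusMod A) :=
    QuotientAddGroup.continuous_mk.comp (by fun_prop)
  have hmaps := map_mem_closure hcont (hS (v 0)) fun x hx => hproj x hx (v 1)
  convert hmaps using 2
  ext i
  fin_cases i <;> rfl

/-- On a second countable Borel group, a probability measure invariant under a dense set of
translations equals every translation invariant probability measure. -/
theorem eq_of_map_add_right_of_dense {G : Type*} [AddCommGroup G] [TopologicalSpace G]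
    [IsTopologicalAddGroup G] [SecondCountableTopology G] [HasOuterApproxClosed G]
    [MeasurableSpace G] [BorelSpace G] (μ ν : Measure G) [IsProbabilityMeasure μ]
    [IsProbabilityMeasure ν] [ν.IsAddLeftInvariant] {D : Set G} (hD : Dense D)
    (hμ : ∀ g ∈ D, μ.map (fun x => x + g) = μ) : μ = ν := by
  refine ext_of_forall_integral_eq_of_IsFiniteMeasure fun f => ?_
  have hcont : Continuous fun g : G => ∫ x, f (x + g) ∂μ :=
    continuous_of_dominated (bound := fun _ => ‖f‖)
      (fun g => (by fun_prop : Continuous fun x => f (x + g)).aestronglyMeasurable)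
      (fun g => ae_of_all _ fun x => f.norm_coe_le_norm _) (integrable_const _)
      (ae_of_all _ fun x => by fun_prop)
  have hconst : ∀ g : G, ∫ x, f (x + g) ∂μ = ∫ x, f x ∂μ := by
    refine fun g => congrFun (hcont.ext_on hD continuous_const fun g hg => ?_) g
    change ∫ x, f (x + g) ∂μ = ∫ x, f x ∂μ
    conv_rhs => rw [← hμ g hg]
    exact (integral_map (by fun_prop) f.continuous.aestronglyMeasurable).symm
  have hint : Integrable (Function.uncurry fun g x : G => f (x + g)) (ν.prod μ) :=
    (integrable_const ‖f‖).mono'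
      (by fun_prop : Continuous fun p : G × G => f (p.2 + p.1)).aestronglyMeasurable
      (ae_of_all _ fun p => f.norm_coe_le_norm _)
  calc ∫ x, f x ∂μ = ∫ g, ∫ x, f (x + g) ∂μ ∂ν := by simp [hconst]
    _ = ∫ x, ∫ g, f (x + g) ∂ν ∂μ := integral_integral_swap hint
    _ = ∫ x, f x ∂ν := by simp [integral_add_left_eq_self (μ := ν) (fun y => f y)]

/-- (Masur's criterion in genus 1) Let `A ∈ SL(2, ℝ)`. If `sys(g_t·Λ_A)` does not tend
to `0` as `t → +∞`, then the vertical flow `ψ_t(x) = x + t·(0,1) mod Λ_A` on `ℝ²/Λ_A`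
is uniquely ergodic: the Haar probability measure on `ℝ²/Λ_A` is the unique Borel
probability measure invariant under `ψ_t` for every `t`. -/
theorem masur_criterion_genus_one
    (A : Matrix (Fin 2) (Fin 2) ℝ) (hA : A.det = 1)
    (h : ¬ Tendsto (fun t : ℝ => sys (latticeSet (gmat t * A))) atTop (𝓝 0)) :
    ∀ ν : Measure (TorusMod A), ν.IsAddHaarMeasure → IsProbabilityMeasure ν →
      ∀ μ : Measure (TorusMod A), IsProbabilityMeasure μ →
        (∀ t : ℝ,
          Measure.map (fun x : TorusMod A =>
            x + (QuotientAddGroup.mk (![0, t] : Fin 2 → ℝ) : TorusMod A)) μ = μ) →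
        μ = ν := by
  intro ν hν hν' μ hμ hinv
  have hv : ∀ q : Fin 2 → ℤ, A 0 0 * q 0 + A 0 1 * q 1 = 0 → q = 0 := by
    intro q hq
    by_contra hne
    exact h (tendsto_sys_of_vertical A hA q hne hq)
  have hclosed : IsClosed (latticeSub A : Set (Fin 2 → ℝ)) := isClosed_latticeSub A hA
  refine eq_of_map_add_right_of_dense μ ν (dense_range_vertical A hv) ?_
  rintro _ ⟨t, rfl⟩
  exact hinv t
end

section
/- (Mahler compactness in genus 1) Let ε > 0 and let (A_n) be a sequence in SL(2, ℝ) such that sys(A_n·ℤ²) ≥ ε for all n, i.e. ‖A_n·q‖ ≥ ε for every nonzero q ∈ ℤ². Then there exist a strictly increasing sequence of indices (n_k) and matrices γ_k ∈ SL(2, ℤ) such that the sequence A_{n_k}·γ_k converges in SL(2, ℝ). -/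
open MeasureTheory Filter Topology

open scoped Modular

/-- A column of a real `2 × 2` matrix, viewed as a complex number. -/
def complexColumn (M : Matrix (Fin 2) (Fin 2) ℝ) (j : Fin 2) : ℂ := ⟨M 0 j, M 1 j⟩

theorem normSq_complexColumn (M : Matrix (Fin 2) (Fin 2) ℝ) (j : Fin 2) :
    Complex.normSq (complexColumn M j) = M 0 j ^ 2 + M 1 j ^ 2 := by
  simp only [complexColumn, Complex.normSq_mk]
  ring

theorem complexColumn_zero_ne_zero {M : Matrix (Fin 2) (Fin 2) ℝ} (hM : M.det = 1) :
    complexColumn M 0 ≠ 0 := by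
  intro h
  have h0 : M 0 0 = 0 := congrArg Complex.re h
  have h1 : M 1 0 = 0 := congrArg Complex.im h
  simp [Matrix.det_fin_two, h0, h1] at hM

theorem im_complexColumn_div {M : Matrix (Fin 2) (Fin 2) ℝ} (hM : M.det = 1) :
    (complexColumn M 1 / complexColumn M 0).im = (Complex.normSq (complexColumn M 0))⁻¹ := by
  rw [Matrix.det_fin_two] at hM
  rw [Complex.div_im, ← sub_div, inv_eq_one_div]
  congr 1
  simp only [complexColumn]
  linarith

/-- Every real matrix of determinant one can be moved by `SL(2, ℤ)`, acting on the right, to a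
matrix whose column ratio lies in the standard fundamental domain. -/
theorem exists_column_ratio_reduced {A : Matrix (Fin 2) (Fin 2) ℝ} (hA : A.det = 1) :
    ∃ γ : Matrix (Fin 2) (Fin 2) ℤ, γ.det = 1 ∧ ∃ τ ∈ 𝒟,
      complexColumn (A * γ.map fun m => (m : ℝ)) 1 /
        complexColumn (A * γ.map fun m => (m : ℝ)) 0 = (τ : ℂ) := by
  have hu := complexColumn_zero_ne_zero hA
  let z : UpperHalfPlane := ⟨complexColumn A 1 / complexColumn A 0, by
    rw [im_complexColumn_div hA]
    exact inv_pos.2 (Complex.normSq_pos.2 hu)⟩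
  obtain ⟨g, hg⟩ := ModularGroup.exists_smul_mem_fd z
  refine ⟨!![g 1 1, g 0 1; g 1 0, g 0 0], ?_, g • z, hg, ?_⟩
  · have := g.det_coe
    rw [Matrix.det_fin_two] at this
    rw [Matrix.det_fin_two_of]
    linarith
  · have hcol (i j : ℤ) (w : ℂ) (hw : w = ⟨A 0 0 * i + A 0 1 * j, A 1 0 * i + A 1 1 * j⟩) :
        w = complexColumn A 0 * (j * (z : ℂ) + i) := by
      have hz : (z : ℂ) = complexColumn A 1 / complexColumn A 0 := rfl
      rw [hz, mul_add, mul_left_comm, mul_div_cancel₀ _ hu, hw]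
      apply Complex.ext <;> simp [complexColumn] <;> ring
    have hcol0 := hcol (g 1 1) (g 1 0)
      (complexColumn (A * !![g 1 1, g 0 1; g 1 0, g 0 0].map fun m => (m : ℝ)) 0)
      (by simp [complexColumn, Matrix.mul_apply])
    have hcol1 := hcol (g 0 1) (g 0 0)
      (complexColumn (A * !![g 1 1, g 0 1; g 1 0, g 0 0].map fun m => (m : ℝ)) 1)
      (by simp [complexColumn, Matrix.mul_apply])
    rw [hcol0, hcol1, mul_div_mul_left _ _ hu, UpperHalfPlane.specialLinearGroup_apply]
    simp

/-- A matrix of determinant one whose column ratio lies in the standard fundamental domain has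
entries bounded in terms of a lower bound for the norm of its first column. -/
theorem abs_entry_le_of_column_ratio_reduced {ε : ℝ} (hε : 0 < ε)
    {M : Matrix (Fin 2) (Fin 2) ℝ} (hM : M.det = 1)
    (hcol : ε ^ 2 ≤ Complex.normSq (complexColumn M 0)) {τ : UpperHalfPlane} (hτ : τ ∈ 𝒟)
    (hratio : complexColumn M 1 / complexColumn M 0 = (τ : ℂ)) (i j : Fin 2) :
    |M i j| ≤ 2 + (ε ^ 2)⁻¹ := by
  set N := Complex.normSq (complexColumn M 0) with hN
  have hε2 : 0 < ε ^ 2 := by positivity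
  have hNpos : 0 < N := hε2.trans_le hcol
  have him : τ.im = N⁻¹ := by
    rw [← im_complexColumn_div hM, hratio, UpperHalfPlane.coe_im]
  have hNle : N ≤ 2 := by
    have h := ModularGroup.three_le_four_mul_im_sq_of_mem_fd hτ
    rw [him] at h
    by_contra! hlt
    have : N⁻¹ < 2⁻¹ := (inv_lt_inv₀ hNpos two_pos).2 hlt
    nlinarith [inv_pos.2 hNpos]
  have hinv : N⁻¹ ≤ (ε ^ 2)⁻¹ := inv_anti₀ hε2 hcol
  have hN1 : Complex.normSq (complexColumn M 1) ≤ 2 + (ε ^ 2)⁻¹ := by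
    have hre : τ.re ^ 2 ≤ 1 := by
      have := abs_le.1 hτ.2
      nlinarith
    have h : Complex.normSq (complexColumn M 1) = N * (τ.re ^ 2 + N⁻¹ ^ 2) := by
      rw [← him, ← div_mul_cancel₀ (complexColumn M 1) (complexColumn_zero_ne_zero hM),
        hratio, Complex.normSq_mul, Complex.normSq_apply (τ : ℂ), UpperHalfPlane.coe_re,
        UpperHalfPlane.coe_im, ← hN]
      ring
    have : N * (τ.re ^ 2 + N⁻¹ ^ 2) = N * τ.re ^ 2 + N⁻¹ := by
      field_simp
    nlinarith
  have hinvpos := inv_pos.2 hε2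
  have hnorm : Complex.normSq (complexColumn M j) ≤ 2 + (ε ^ 2)⁻¹ := by
    fin_cases j
    · exact hNle.trans (by linarith)
    · exact hN1
  rw [normSq_complexColumn] at hnorm
  apply abs_le_of_sq_le_sq _ (by positivity)
  fin_cases i <;> simp only [Fin.zero_eta, Fin.mk_one] <;>
    nlinarith [sq_nonneg (M 0 j), sq_nonneg (M 1 j)]

/-- Right translates of a lattice basis have first column bounded below by the systole. -/
theorem sq_le_normSq_complexColumn_mul {ε : ℝ} (hε : 0 < ε) {A : Matrix (Fin 2) (Fin 2) ℝ}
    (hsys : ∀ q : Fin 2 → ℤ, q ≠ 0 → ε ≤ vnorm (A.mulVec fun i => (q i : ℝ)))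
    {γ : Matrix (Fin 2) (Fin 2) ℤ} (hγ : γ.det = 1) :
    ε ^ 2 ≤ Complex.normSq (complexColumn (A * γ.map fun m => (m : ℝ)) 0) := by
  have hq : (fun i => γ i 0) ≠ 0 := by
    intro h
    have h0 := congrFun h 0
    have h1 := congrFun h 1
    simp only [Pi.zero_apply] at h0 h1
    simp [Matrix.det_fin_two, h0, h1] at hγ
  have h := (Real.le_sqrt' hε).1 (hsys _ hq)
  rw [normSq_complexColumn]
  exact h

/-- (Mahler compactness in genus 1) Let `ε > 0` and let `(A_n)` be a sequence in
`SL(2, ℝ)` with `sys(A_n·ℤ²) ≥ ε` for all `n`, i.e. `‖A_n·q‖ ≥ ε` for every nonzero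
`q ∈ ℤ²`. Then there is a strictly increasing sequence of indices `(n_k)` and matrices
`γ_k ∈ SL(2, ℤ)` such that `A_{n_k}·γ_k` converges in `SL(2, ℝ)`. -/
theorem mahler_compactness_genus_one (ε : ℝ) (hε : 0 < ε)
    (A : ℕ → Matrix (Fin 2) (Fin 2) ℝ) (hdet : ∀ n, (A n).det = 1)
    (hsys : ∀ n, ∀ q : Fin 2 → ℤ, q ≠ 0 → ε ≤ vnorm ((A n).mulVec fun i => (q i : ℝ))) :
    ∃ nk : ℕ → ℕ, StrictMono nk ∧
      ∃ γ : ℕ → Matrix (Fin 2) (Fin 2) ℤ, (∀ k, (γ k).det = 1) ∧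
        ∃ L : Matrix (Fin 2) (Fin 2) ℝ, L.det = 1 ∧
          Tendsto (fun k => A (nk k) * (γ k).map fun m => (m : ℝ)) atTop (𝓝 L) := by
  choose γ hγ τ hτ hratio using fun n => exists_column_ratio_reduced (hdet n)
  let B : ℕ → Fin 2 → Fin 2 → ℝ := fun n => A n * (γ n).map fun m => (m : ℝ)
  have hB (n : ℕ) : Matrix.det (B n) = 1 := by
    have hmap : ((γ n).map fun m => (m : ℝ)).det = 1 := by
      have := congrArg (Int.cast : ℤ → ℝ) (hγ n)
      simpa [Matrix.det_fin_two] using this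
    exact (Matrix.det_mul _ _).trans (by rw [hdet n, hmap, one_mul])
  let R := 2 + (ε ^ 2)⁻¹
  have hK : IsCompact (Set.univ.pi fun _ : Fin 2 => Set.univ.pi fun _ : Fin 2 => Set.Icc (-R) R) :=
    isCompact_univ_pi fun _ => isCompact_univ_pi fun _ => isCompact_Icc
  obtain ⟨L, -, φ, hφ, hL⟩ := hK.tendsto_subseq (x := B) fun n i _ j _ =>
    abs_le.1 (abs_entry_le_of_column_ratio_reduced hε (hB n)
      (sq_le_normSq_complexColumn_mul hε (hsys n) (hγ n)) (hτ n) (hratio n) i j)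
  have hcont : Continuous (Matrix.det : Matrix (Fin 2) (Fin 2) ℝ → ℝ) :=
    continuous_id.matrix_det
  refine ⟨φ, hφ, γ ∘ φ, fun k => hγ _, L, ?_, hL⟩
  refine tendsto_nhds_unique ((hcont.tendsto L).comp hL) ?_
  exact tendsto_const_nhds.congr fun k => (hB (φ k)).symm
end

section
/- For all s₀ > 0 and c > 0 there exist constants ε̄ > 0, T > 0 and K > 0 such that for every v ∈ ℝ² with ‖v‖ ≥ s₀, every t ≥ T, and every ε with 0 < ε ≤ ε̄, the Lebesgue measure of {θ ∈ [0, 2π) : ‖g_t·R_θ·v‖ ≤ ε} is at most K·ε times the Lebesgue measure of {θ ∈ [0, 2π) : ‖g_t·R_θ·v‖ ≤ c}. -/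
open MeasureTheory Filter Topology Real

/-- The rotation matrix `R_θ`. -/
noncomputable def rmat (θ : ℝ) : Matrix (Fin 2) (Fin 2) ℝ :=
  !![Real.cos θ, -Real.sin θ; Real.sin θ, Real.cos θ]

/-- A vector of `ℝ²` in polar form, with a signed radius and an angle in `[0, π)`. -/
lemma exists_signed_polar (v : Fin 2 → ℝ) :
    ∃ ρ α : ℝ, |ρ| = vnorm v ∧ 0 ≤ α ∧ α < π ∧
      v 0 = -(ρ * Real.sin α) ∧ v 1 = -(ρ * Real.cos α) := by
  set z : ℂ := ⟨-v 1, -v 0⟩ with hz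
  have hnorm : ‖z‖ = vnorm v := by
    rw [Complex.norm_eq_sqrt_sq_add_sq, vnorm]
    congr 1
    simp only [hz]
    ring
  have hre : ‖z‖ * Real.cos z.arg = -v 1 := Complex.norm_mul_cos_arg z
  have him : ‖z‖ * Real.sin z.arg = -v 0 := Complex.norm_mul_sin_arg z
  rcases lt_or_ge z.arg 0 with h | h
  · refine ⟨-‖z‖, z.arg + π, ?_, ?_, ?_, ?_, ?_⟩
    · rw [abs_neg, abs_norm, hnorm]
    · linarith [Complex.neg_pi_lt_arg z]
    · linarith
    · rw [Real.sin_add_pi]; linarith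
    · rw [Real.cos_add_pi]; linarith
  · rcases (Complex.arg_le_pi z).eq_or_lt with h' | h'
    · rw [h', Real.cos_pi] at hre
      rw [h', Real.sin_pi] at him
      refine ⟨-‖z‖, 0, ?_, le_rfl, Real.pi_pos, ?_, ?_⟩
      · rw [abs_neg, abs_norm, hnorm]
      · rw [Real.sin_zero]; linarith
      · rw [Real.cos_zero]; linarith
    · exact ⟨‖z‖, z.arg, by rw [abs_norm, hnorm], h, h', by linarith, by linarith⟩

/-- The norm of `g_t R_θ v` in terms of the polar form of `v`. -/
lemma vnorm_gmat_rmat_mulVec {v : Fin 2 → ℝ} {ρ α : ℝ} (h0 : v 0 = -(ρ * Real.sin α))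
    (h1 : v 1 = -(ρ * Real.cos α)) (t θ : ℝ) :
    vnorm ((gmat t * rmat θ).mulVec v) =
      Real.sqrt ((Real.exp t * (ρ * Real.sin (θ - α))) ^ 2 +
        (Real.exp (-t) * (ρ * Real.cos (θ - α))) ^ 2) := by
  rw [vnorm, Real.sin_sub, Real.cos_sub]
  congr 1
  simp only [gmat, rmat, Matrix.mulVec, dotProduct, Matrix.mul_apply, Fin.sum_univ_two, h0, h1,
    Matrix.of_apply, Matrix.cons_val', Matrix.cons_val_zero, Matrix.cons_val_one,
    Matrix.cons_val_fin_one]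
  ring

/-- The set of angles in `[0, 2π)` where `|sin (θ - α)|` is at most `a` has measure `O(a)`. -/
lemma volume_abs_sin_sub_le {α a : ℝ} (hα₀ : 0 ≤ α) (hα : α < π) :
    volume {θ ∈ Set.Ico (0 : ℝ) (2 * π) | |Real.sin (θ - α)| ≤ a} ≤
      ENNReal.ofReal (4 * π * a) := by
  have key : ∀ x : ℝ, |x| ≤ π / 2 → |Real.sin x| ≤ a → |x| ≤ π / 2 * a := by
    intro x hx hs
    have h := (Real.mul_abs_le_abs_sin hx).trans hs
    have hpi := Real.pi_pos
    calc |x| = π / 2 * (2 / π * |x|) := by field_simp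
      _ ≤ π / 2 * a := by gcongr
  let J : ℝ → Set ℝ := fun x => Set.Icc (x - π / 2 * a) (x + π / 2 * a)
  have memJ : ∀ x θ : ℝ, |θ - x| ≤ π / 2 → |Real.sin (θ - x)| ≤ a → θ ∈ J x := by
    intro x θ hx hs
    have h := abs_le.1 (key _ hx hs)
    exact ⟨by linarith [h.1], by linarith [h.2]⟩
  have hsub : {θ ∈ Set.Ico (0 : ℝ) (2 * π) | |Real.sin (θ - α)| ≤ a} ⊆
      ⋃ k : Fin 4, J (α + ((k : ℝ) - 1) * π) := by
    rintro θ ⟨⟨h1, h2⟩, hs⟩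
    have hs' : ∀ n : ℤ, |Real.sin (θ - (α + n * π))| ≤ a := by
      intro n
      rwa [← sub_sub, Real.sin_sub_int_mul_pi, abs_mul, abs_zpow, abs_neg, abs_one, one_zpow,
        one_mul]
    rw [Set.mem_iUnion]
    have hk : ∃ k : Fin 4, |θ - (α + ((k : ℝ) - 1) * π)| ≤ π / 2 := by
      simp only [abs_le]
      rcases le_total (θ - α) (-(π / 2)) with h | h
      · exact ⟨0, by norm_num; constructor <;> linarith⟩
      rcases le_total (θ - α) (π / 2) with h' | h'
      · exact ⟨1, by norm_num; constructor <;> linarith⟩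
      rcases le_total (θ - α) (3 * π / 2) with h'' | h''
      · exact ⟨2, by norm_num; constructor <;> linarith⟩
      · exact ⟨3, by norm_num; constructor <;> linarith⟩
    obtain ⟨k, hk⟩ := hk
    refine ⟨k, memJ _ _ hk ?_⟩
    simpa using hs' ((k : ℤ) - 1)
  have hJ : ∀ x, volume (J x) = ENNReal.ofReal (π * a) := by
    intro x
    rw [Real.volume_Icc]
    congr 1
    ring
  calc _ ≤ ∑ k : Fin 4, volume (J (α + ((k : ℝ) - 1) * π)) :=
        (measure_mono hsub).trans (measure_iUnion_fintype_le _ _)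
    _ = ENNReal.ofReal (4 * π * a) := by
        simp only [hJ, Finset.sum_const, Finset.card_univ, Fintype.card_fin, nsmul_eq_mul]
        rw [mul_assoc, ENNReal.ofReal_mul (p := 4) (by norm_num)]
        norm_num

/-- The set of angles in `[0, 2π)` where `|sin (θ - α)|` is at most `b` has measure at least `b`. -/
lemma le_volume_abs_sin_sub_le {α b : ℝ} (hα₀ : 0 ≤ α) (hα : α < π) (hb : b ≤ 1) :
    ENNReal.ofReal b ≤ volume {θ ∈ Set.Ico (0 : ℝ) (2 * π) | |Real.sin (θ - α)| ≤ b} := by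
  have hsub : Set.Icc α (α + b) ⊆ {θ ∈ Set.Ico (0 : ℝ) (2 * π) | |Real.sin (θ - α)| ≤ b} := by
    rintro θ ⟨h1, h2⟩
    refine ⟨⟨hα₀.trans h1, by linarith [Real.pi_gt_three]⟩, Real.abs_sin_le_abs.trans ?_⟩
    rw [abs_of_nonneg (by linarith)]
    linarith
  calc ENNReal.ofReal b = volume (Set.Icc α (α + b)) := by rw [Real.volume_Icc, add_sub_cancel_left]
    _ ≤ _ := measure_mono hsub

/-- For all `s₀ > 0` and `c > 0` there are constants `ε̄ > 0`, `T > 0`, `K > 0` such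
that for every `v ∈ ℝ²` with `‖v‖ ≥ s₀`, every `t ≥ T` and every `0 < ε ≤ ε̄`, the
Lebesgue measure of `{θ ∈ [0, 2π) : ‖g_t·R_θ·v‖ ≤ ε}` is at most `K·ε` times the
Lebesgue measure of `{θ ∈ [0, 2π) : ‖g_t·R_θ·v‖ ≤ c}`. -/
theorem small_measure_of_short_directions (s₀ c : ℝ) (hs₀ : 0 < s₀) (hc : 0 < c) :
    ∃ εbar T K : ℝ, 0 < εbar ∧ 0 < T ∧ 0 < K ∧
      ∀ v : Fin 2 → ℝ, s₀ ≤ vnorm v → ∀ t : ℝ, T ≤ t → ∀ ε : ℝ, 0 < ε → ε ≤ εbar →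
        volume {θ ∈ Set.Ico (0 : ℝ) (2 * π) | vnorm ((gmat t * rmat θ).mulVec v) ≤ ε}
          ≤ ENNReal.ofReal (K * ε) *
            volume {θ ∈ Set.Ico (0 : ℝ) (2 * π) | vnorm ((gmat t * rmat θ).mulVec v) ≤ c} := by
  refine ⟨c / 2, c / s₀, 8 * π / c, by positivity, by positivity, by positivity, ?_⟩
  intro v hv t ht ε hε hεc
  obtain ⟨ρ, α, hρ, hα₀, hα, h0, h1⟩ := exists_signed_polar v
  simp only [vnorm_gmat_rmat_mulVec h0 h1]
  set r := |ρ| with hr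
  have hs : s₀ ≤ r := hv.trans hρ.ge
  have hrpos : 0 < r := hs₀.trans_le hs
  have hE := Real.exp_pos t
  have hE' := Real.exp_pos (-t)
  have hEr : 0 < Real.exp t * r := by positivity
  by_cases hlong : ε < Real.exp (-t) * r
  · have hempty : {θ ∈ Set.Ico (0 : ℝ) (2 * π) |
        Real.sqrt ((Real.exp t * (ρ * Real.sin (θ - α))) ^ 2 +
          (Real.exp (-t) * (ρ * Real.cos (θ - α))) ^ 2) ≤ ε} = ∅ := by
      refine Set.eq_empty_of_forall_notMem fun θ hθ => hlong.not_ge (le_trans ?_ hθ.2)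
      apply Real.le_sqrt_of_sq_le
      have hexp : Real.exp (-t) ^ 2 ≤ Real.exp t ^ 2 := by
        have : 0 ≤ t := (by positivity : 0 ≤ c / s₀).trans ht
        gcongr
        linarith
      have hmul := mul_le_mul_of_nonneg_right hexp (sq_nonneg (ρ * Real.sin (θ - α)))
      calc (Real.exp (-t) * r) ^ 2
          = Real.exp (-t) ^ 2 * (ρ * Real.sin (θ - α)) ^ 2 +
            (Real.exp (-t) * (ρ * Real.cos (θ - α))) ^ 2 := by
            rw [mul_pow, hr, sq_abs]
            linear_combination (-Real.exp (-t) ^ 2 * ρ ^ 2) * Real.sin_sq_add_cos_sq (θ - α)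
        _ ≤ _ := by rw [mul_pow (Real.exp t)]; gcongr
    rw [hempty, measure_empty]
    exact zero_le
  · push Not at hlong
    have hupper : {θ ∈ Set.Ico (0 : ℝ) (2 * π) |
        Real.sqrt ((Real.exp t * (ρ * Real.sin (θ - α))) ^ 2 +
          (Real.exp (-t) * (ρ * Real.cos (θ - α))) ^ 2) ≤ ε} ⊆
        {θ ∈ Set.Ico (0 : ℝ) (2 * π) | |Real.sin (θ - α)| ≤ ε / (Real.exp t * r)} := by
      refine fun θ hθ => ⟨hθ.1, ?_⟩
      have h : |Real.exp t * (ρ * Real.sin (θ - α))| ≤ ε :=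
        (Real.abs_le_sqrt (le_add_of_nonneg_right (sq_nonneg _))).trans hθ.2
      rw [abs_mul, abs_mul, Real.abs_exp, ← mul_assoc] at h
      rwa [le_div_iff₀' hEr]
    have hlower : {θ ∈ Set.Ico (0 : ℝ) (2 * π) |
          |Real.sin (θ - α)| ≤ c / 2 / (Real.exp t * r)} ⊆
        {θ ∈ Set.Ico (0 : ℝ) (2 * π) |
          Real.sqrt ((Real.exp t * (ρ * Real.sin (θ - α))) ^ 2 +
            (Real.exp (-t) * (ρ * Real.cos (θ - α))) ^ 2) ≤ c} := by
      refine fun θ hθ => ⟨hθ.1, ?_⟩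
      have hsin : |Real.exp t * (ρ * Real.sin (θ - α))| ≤ c / 2 := by
        have h := hθ.2
        rw [le_div_iff₀' hEr] at h
        rwa [abs_mul, abs_mul, Real.abs_exp, ← mul_assoc]
      have hcos : |Real.exp (-t) * (ρ * Real.cos (θ - α))| ≤ c / 2 := by
        rw [abs_mul, abs_mul, Real.abs_exp, ← mul_assoc]
        exact (mul_le_of_le_one_right (by positivity) (Real.abs_cos_le_one _)).trans
          (hlong.trans hεc)
      have hsin' := sq_le_sq' (abs_le.1 hsin).1 (abs_le.1 hsin).2
      have hcos' := sq_le_sq' (abs_le.1 hcos).1 (abs_le.1 hcos).2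
      rw [Real.sqrt_le_left hc.le]
      nlinarith
    have hb : c / 2 / (Real.exp t * r) ≤ 1 := by
      have hexp : c / s₀ ≤ Real.exp t := by linarith [Real.add_one_le_exp t]
      have hcE : c ≤ Real.exp t * r := by
        rw [div_le_iff₀ hs₀] at hexp
        exact hexp.trans (by gcongr)
      rw [div_le_one hEr]
      linarith
    calc _ ≤ ENNReal.ofReal (4 * π * (ε / (Real.exp t * r))) :=
          (measure_mono hupper).trans (volume_abs_sin_sub_le hα₀ hα)
      _ = ENNReal.ofReal (8 * π / c * ε) * ENNReal.ofReal (c / 2 / (Real.exp t * r)) := by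
          rw [← ENNReal.ofReal_mul (by positivity)]
          congr 1
          field_simp
          ring
      _ ≤ _ := by
          gcongr
          exact (le_volume_abs_sin_sub_le hα₀ hα hb).trans (measure_mono hlower)
end

section
/- Let ε₀ > 0 and let A, B, C be points of the Euclidean plane ℝ² such that the area of the triangle with vertices A, B, C (the Lebesgue measure of the convex hull of {A, B, C}) is at most 1, dist(A, B) ≥ ε₀, dist(B, C) ≥ ε₀, dist(A, B) ≤ K and dist(B, C) ≤ K, where K = dist(A, C) satisfies K ≥ 4/(√3·ε₀). Let H be the orthogonal projection of B onto the line through A and C. Then dist(B, H) ≤ 2/K, dist(A, H) ≥ ε₀/2 and dist(C, H) ≥ ε₀/2. -/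
open MeasureTheory EuclideanGeometry

/-- The parallelogram spanned by `b - a` and `c - a` is covered by the translates of the triangle
`a b c` and of its point reflection. -/
theorem addHaar_parallelepiped_le_two_mul_triangle {E : Type*} [NormedAddCommGroup E]
    [NormedSpace ℝ E] [FiniteDimensional ℝ E] [MeasurableSpace E] [BorelSpace E] (μ : Measure E)
    [μ.IsAddHaarMeasure] (a b c : E) :
    μ (parallelepiped ![b - a, c - a]) ≤ 2 * μ (convexHull ℝ {a, b, c}) := by
  set T := convexHull ℝ ({a, b, c} : Set E) with hT
  have mem_triangle (x y : ℝ) (hx : 0 ≤ x) (hy : 0 ≤ y) (hxy : x + y ≤ 1) :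
      a + (x • (b - a) + y • (c - a)) ∈ T := by
    have h := (convex_convexHull ℝ ({a, b, c} : Set E)).sum_mem (t := Finset.univ)
      (w := ![1 - x - y, x, y]) (z := ![a, b, c])
      (by simp [Fin.forall_fin_succ, hx, hy]; linarith) (by simp [Fin.sum_univ_three]; ring)
      (fun i _ ↦ subset_convexHull ℝ _ (by fin_cases i <;> simp))
    simp only [Fin.sum_univ_three, Matrix.cons_val] at h
    convert h using 1
    module
  have hsub : parallelepiped ![b - a, c - a] ⊆
      (fun p ↦ a + p) ⁻¹' T ∪ (fun p ↦ (b + c - a) - p) ⁻¹' T := by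
    intro p hp
    obtain ⟨t, ht, rfl⟩ := (mem_parallelepiped_iff _ _).1 hp
    simp only [Fin.sum_univ_two, Matrix.cons_val_zero, Matrix.cons_val_one]
    rcases le_total (t 0 + t 1) 1 with h | h
    · exact Or.inl (mem_triangle _ _ (ht.1 0) (ht.1 1) h)
    · right
      have h0 : t 0 ≤ 1 := ht.2 0
      have h1 : t 1 ≤ 1 := ht.2 1
      have := mem_triangle (1 - t 0) (1 - t 1) (by linarith) (by linarith) (by linarith)
      rw [Set.mem_preimage]
      convert this using 1
      module
  have hmeas : MeasurableSet T :=
    ((Set.toFinite _).isCompact_convexHull ℝ).isClosed.measurableSet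
  calc μ (parallelepiped ![b - a, c - a])
      ≤ μ ((fun p ↦ a + p) ⁻¹' T) + μ ((fun p ↦ (b + c - a) - p) ⁻¹' T) :=
        (measure_mono hsub).trans (measure_union_le _ _)
    _ = 2 * μ T := by
        rw [measure_preimage_add, (Measure.measurePreserving_sub_left μ _).measure_preimage
          hmeas.nullMeasurableSet, two_mul]

/-- A plane triangle has area at least half the absolute determinant of two of its edges. -/
theorem EuclideanSpace.ofReal_abs_det_le_two_mul_volume_triangle
    (a b c : EuclideanSpace ℝ (Fin 2)) :
    ENNReal.ofReal |(b 0 - a 0) * (c 1 - a 1) - (b 1 - a 1) * (c 0 - a 0)| ≤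
      2 * volume (convexHull ℝ {a, b, c}) := by
  have h := addHaar_parallelepiped_le_two_mul_triangle volume a b c
  rw [← (EuclideanSpace.basisFun (Fin 2) ℝ).addHaar_eq_volume, Measure.addHaar_parallelepiped,
    (EuclideanSpace.basisFun (Fin 2) ℝ).addHaar_eq_volume] at h
  convert h using 3
  rw [Module.Basis.det_apply, Matrix.det_fin_two]
  simp [Module.Basis.toMatrix_apply]
  ring

/-- A point of a line closest to `B` is the foot of the perpendicular from `B`. -/
theorem inner_sub_sub_eq_zero_of_forall_dist_le {E : Type*} [NormedAddCommGroup E]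
    [InnerProductSpace ℝ E] {A B C H : E} (hH : H ∈ affineSpan ℝ ({A, C} : Set E))
    (hmin : ∀ Q ∈ affineSpan ℝ ({A, C} : Set E), dist B H ≤ dist B Q) :
    inner ℝ (B - H) (C - A) = 0 := by
  have hle (s : ℝ) : 0 ≤ s * s * ‖C - A‖ ^ 2 - s * (2 * inner ℝ (B - H) (C - A)) := by
    have hQ := hmin (s • (C - A) + H)
      (AffineSubspace.vadd_mem_of_mem_direction (Submodule.smul_mem _ s
        (AffineSubspace.vsub_mem_direction (right_mem_affineSpan_pair ℝ A C)
          (left_mem_affineSpan_pair ℝ A C))) hH)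
    rw [dist_eq_norm, dist_eq_norm, show B - (s • (C - A) + H) = (B - H) - s • (C - A) by abel,
      ← sq_le_sq₀ (norm_nonneg _) (norm_nonneg _), norm_sub_sq_real (B - H),
      inner_smul_right, norm_smul, mul_pow, Real.norm_eq_abs, sq_abs] at hQ
    linarith
  have := discrim_le_zero (a := ‖C - A‖ ^ 2) (b := -(2 * inner ℝ (B - H) (C - A))) (c := 0)
    fun s ↦ by linarith [hle s]
  rw [discrim] at this
  nlinarith [sq_nonneg (inner ℝ (B - H) (C - A))]

/-- Let `ε₀ > 0` and let `A, B, C` be points of the Euclidean plane such that the area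
of the triangle `ABC` is at most `1`, `dist A B ≥ ε₀`, `dist B C ≥ ε₀`,
`dist A B ≤ K`, `dist B C ≤ K`, where `K = dist A C ≥ 4/(√3·ε₀)`. If `H` is the
orthogonal projection of `B` onto the line through `A` and `C` (the point of that line
minimizing the distance to `B`), then `dist B H ≤ 2/K`, `dist A H ≥ ε₀/2` and
`dist C H ≥ ε₀/2`. -/
theorem triangle_retriangulation_estimates (ε₀ : ℝ) (hε₀ : 0 < ε₀)
    (A B C H : EuclideanSpace ℝ (Fin 2))
    (harea : volume (convexHull ℝ ({A, B, C} : Set (EuclideanSpace ℝ (Fin 2)))) ≤ 1)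
    (hAB : ε₀ ≤ dist A B) (hBC : ε₀ ≤ dist B C)
    (hABK : dist A B ≤ dist A C) (hBCK : dist B C ≤ dist A C)
    (hK : 4 / (Real.sqrt 3 * ε₀) ≤ dist A C)
    (hH₁ : H ∈ affineSpan ℝ ({A, C} : Set (EuclideanSpace ℝ (Fin 2))))
    (hH₂ : ∀ Q ∈ affineSpan ℝ ({A, C} : Set (EuclideanSpace ℝ (Fin 2))), dist B H ≤ dist B Q) :
    dist B H ≤ 2 / dist A C ∧ ε₀ / 2 ≤ dist A H ∧ ε₀ / 2 ≤ dist C H := by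
  have hperp := inner_sub_sub_eq_zero_of_forall_dist_le hH₁ hH₂
  have hs : 0 < Real.sqrt 3 := by positivity
  have hs2 : Real.sqrt 3 ^ 2 = 3 := Real.sq_sqrt (by norm_num)
  have hKpos : 0 < dist A C := lt_of_lt_of_le (by positivity) hK
  obtain ⟨t, ht⟩ : ∃ t : ℝ, t • (C - A) = H - A := by
    rw [← vsub_vadd H A] at hH₁
    exact vadd_left_mem_affineSpan_pair.1 hH₁
  obtain rfl : H = A + t • (C - A) := by rw [ht]; abel
  set H := A + t • (C - A) with hH
  have hdet : |(B 0 - A 0) * (C 1 - A 1) - (B 1 - A 1) * (C 0 - A 0)| ≤ 2 := by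
    have h := (EuclideanSpace.ofReal_abs_det_le_two_mul_volume_triangle A B C).trans
      (mul_le_mul_right harea 2)
    rw [mul_one, ENNReal.ofReal_le_ofNat] at h
    exact h
  have hprod : dist B H * dist A C ≤ 2 := by
    refine le_trans (le_of_eq ?_) hdet
    rw [← sq_eq_sq₀ (by positivity) (abs_nonneg _), sq_abs, mul_pow,
      EuclideanSpace.dist_sq_eq, EuclideanSpace.dist_sq_eq]
    have hcoord (i : Fin 2) : H i = A i + t * (C i - A i) := by simp [hH]
    simp only [PiLp.inner_apply, PiLp.sub_apply, Fin.sum_univ_two, Real.dist_eq, sq_abs,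
      RCLike.inner_apply, conj_trivial, hcoord] at hperp ⊢
    linear_combination ((C 0 - A 0) * (B 0 - (A 0 + t * (C 0 - A 0))) +
      (C 1 - A 1) * (B 1 - (A 1 + t * (C 1 - A 1)))) * hperp
  have hBH : dist B H ≤ 2 / dist A C := (le_div_iff₀ hKpos).2 hprod
  have hBH2 : dist B H ^ 2 ≤ 3 / 4 * ε₀ ^ 2 := by
    have h : dist B H ≤ Real.sqrt 3 * ε₀ / 2 := by
      refine hBH.trans ?_
      rw [div_le_iff₀ (by positivity)] at hK ⊢
      nlinarith
    calc dist B H ^ 2 ≤ (Real.sqrt 3 * ε₀ / 2) ^ 2 := by gcongr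
      _ = 3 / 4 * ε₀ ^ 2 := by rw [div_pow, mul_pow, hs2]; ring
  have foot_le (P : EuclideanSpace ℝ (Fin 2)) (r : ℝ) (hP : P - H = r • (C - A))
      (hPB : ε₀ ≤ dist P B) : ε₀ / 2 ≤ dist P H := by
    have hpyth : dist P B ^ 2 = dist P H ^ 2 + dist B H ^ 2 := by
      rw [dist_eq_norm, dist_eq_norm, dist_eq_norm, ← sub_sub_sub_cancel_right P B H,
        norm_sub_sq_real, hP, inner_smul_left, real_inner_comm, hperp]
      ring
    rw [← sq_le_sq₀ (by positivity) dist_nonneg]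
    nlinarith
  refine ⟨hBH, foot_le A (-t) ?_ hAB, foot_le C (1 - t) ?_ (dist_comm B C ▸ hBC)⟩
  · rw [hH]
    module
  · rw [hH]
    module
end
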